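/- For the supercommutator in End(EPol_n) (with ω_i^± odd and X_i, T_r even): [Σ_{i=1}^n P_i ω_i^-, T_r] = 0, where P_1 = X_1^N, P_{r+1} = -∂_r(P_r), and T_r = ∂_r. In particular, using [P, T_r] = ∂_r(P)((X_{r+1} - X_r)T_r - 1) for any polynomial P and [ω_{r+1}^-, T_r] = ((X_r - X_{r+1})T_r - 1)ω_r^-, one has [P_r, T_r]ω_r^- + P_{r+1}[ω_{r+1}^-, T_r] = 0. -/

import Mathlib

open MvPolynomial
open scoped TensorProduct

noncomputable section

abbrev EPol (k : Type) [Field k] (n : ℕ) :=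
  TensorProduct k (MvPolynomial (Fin n) k) (ExteriorAlgebra k (Fin n → k))

def XE (k : Type) [Field k] (n : ℕ) (i : Fin n) : EPol k n := (X i) ⊗ₜ[k] 1

def wE (k : Type) [Field k] (n : ℕ) (i : Fin n) : EPol k n :=
  1 ⊗ₜ[k] (ExteriorAlgebra.ι k (Pi.single i (1 : k)))

def PE (k : Type) [Field k] (n : ℕ) (P : MvPolynomial (Fin n) k) : EPol k n := P ⊗ₜ[k] 1

def fr (n r : ℕ) (hr : r + 1 < n) : Fin n := ⟨r, Nat.lt_of_succ_lt hr⟩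
def fr1 (n r : ℕ) (hr : r + 1 < n) : Fin n := ⟨r + 1, hr⟩

lemma swap_braid {n : ℕ} (x y z : Fin n) (hxy : x ≠ y) (hxz : x ≠ z) (hyz : y ≠ z) :
    (⇑(Equiv.swap x y) ∘ ⇑(Equiv.swap y z)) ∘ ⇑(Equiv.swap x y) =
      (⇑(Equiv.swap y z) ∘ ⇑(Equiv.swap x y)) ∘ ⇑(Equiv.swap y z) := by
  funext w
  simp only [Function.comp, Equiv.swap_apply_def]
  grind

lemma swap_far {n : ℕ} (a b c d : Fin n) (h1 : a ≠ c) (h2 : a ≠ d) (h3 : b ≠ c) (h4 : b ≠ d) :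
    ⇑(Equiv.swap c d) ∘ ⇑(Equiv.swap a b) = ⇑(Equiv.swap a b) ∘ ⇑(Equiv.swap c d) := by
  funext w
  simp only [Function.comp, Equiv.swap_apply_def]
  grind

lemma EPol_mul_neg (k : Type) [Field k] (n : ℕ) (x y : EPol k n) : x * -y = -(x * y) := by
  rw [eq_neg_iff_add_eq_zero, ← mul_add, neg_add_cancel, mul_zero]

lemma EPol_neg_mul (k : Type) [Field k] (n : ℕ) (x y : EPol k n) : -x * y = -(x * y) := by
  rw [eq_neg_iff_add_eq_zero, ← add_mul, neg_add_cancel, zero_mul]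

lemma PE_comm (k : Type) [Field k] (n : ℕ) (p : MvPolynomial (Fin n) k) (x : EPol k n) :
    x * PE k n p = PE k n p * x := by
  unfold PE
  induction x using TensorProduct.induction_on with
  | zero => simp
  | tmul q e => simp [Algebra.TensorProduct.tmul_mul_tmul, mul_comm]
  | add x y hx hy => rw [add_mul, mul_add, hx, hy]

lemma PE_mul (k : Type) [Field k] (n : ℕ) (p q : MvPolynomial (Fin n) k) :
    PE k n (p * q) = PE k n p * PE k n q := by
  simp [PE, Algebra.TensorProduct.tmul_mul_tmul]

lemma PE_sub (k : Type) [Field k] (n : ℕ) (p q : MvPolynomial (Fin n) k) :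
    PE k n (p - q) = PE k n p - PE k n q := by
  simp [PE, TensorProduct.sub_tmul]

lemma PE_one (k : Type) [Field k] (n : ℕ) : PE k n 1 = 1 := rfl

lemma PE_inj (k : Type) [Field k] (n : ℕ) (p : MvPolynomial (Fin n) k) (hp : p ≠ 0)
    (x y : EPol k n) (h : PE k n p * x = PE k n p * y) : x = y := by
  have h1 : Function.Injective (LinearMap.rTensor (ExteriorAlgebra k (Fin n → k))
      (LinearMap.mulLeft k p)) := by
    apply Module.Flat.rTensor_preserves_injective_linearMap
    intro a b hab
    exact mul_left_cancel₀ hp hab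
  have h2 : ∀ z : EPol k n, LinearMap.rTensor (ExteriorAlgebra k (Fin n → k))
      (LinearMap.mulLeft k p) z = PE k n p * z := by
    intro z
    unfold PE
    induction z using TensorProduct.induction_on with
    | zero => simp
    | tmul q e => simp [Algebra.TensorProduct.tmul_mul_tmul]
    | add x y hx hy => rw [map_add, mul_add, hx, hy]
  apply h1
  rw [h2, h2, h]

lemma skew_zero (k : Type) [Field k] (n : ℕ) (H : EPol k n →ₗ[k] EPol k n)
    (s t : EPol k n → EPol k n)
    (hH : ∀ x y, H (x * y) = H x * s y + t x * H y)
    (hP : ∀ p, H (PE k n p) = 0) (hw : ∀ i, H (wE k n i) = 0) : ∀ x, H x = 0 := by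
  have hE : ∀ e : ExteriorAlgebra k (Fin n → k),
      H ((1 : MvPolynomial (Fin n) k) ⊗ₜ[k] e) = 0 := by
    intro e
    induction e using ExteriorAlgebra.induction with
    | algebraMap c =>
      have : (1 : MvPolynomial (Fin n) k) ⊗ₜ[k] (algebraMap k (ExteriorAlgebra k (Fin n → k)) c)
          = PE k n (c • 1) := by
        rw [PE, Algebra.algebraMap_eq_smul_one, TensorProduct.tmul_smul, TensorProduct.smul_tmul']
      rw [this, hP]
    | ι v =>
      have : (1 : MvPolynomial (Fin n) k) ⊗ₜ[k] (ExteriorAlgebra.ι k v)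
          = ∑ i, v i • wE k n i := by
        conv_lhs => rw [← Finset.univ_sum_single v]
        rw [map_sum, TensorProduct.tmul_sum]
        refine Finset.sum_congr rfl fun i _ => ?_
        rw [wE, ← TensorProduct.tmul_smul, ← map_smul]
        congr 2
        ext j
        simp [Pi.single_apply]
      rw [this, map_sum]
      simp [hw]
    | mul a b ha hb =>
      have : (1 : MvPolynomial (Fin n) k) ⊗ₜ[k] (a * b) =
          ((1 : MvPolynomial (Fin n) k) ⊗ₜ[k] a : EPol k n) * (1 ⊗ₜ[k] b) := by
        simp [Algebra.TensorProduct.tmul_mul_tmul]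
      rw [this, hH, ha, hb]; simp
    | add a b ha hb => rw [TensorProduct.tmul_add, map_add, ha, hb, add_zero]
  intro x
  induction x using TensorProduct.induction_on with
  | zero => simp
  | tmul q e =>
    have : (q ⊗ₜ[k] e : EPol k n) = PE k n q * (1 ⊗ₜ[k] e) := by
      simp [PE, Algebra.TensorProduct.tmul_mul_tmul]
    rw [this, hH, hP, hE]; simp
  | add x y hx hy => rw [map_add, hx, hy, add_zero]

lemma hom_ext (k : Type) [Field k] (n : ℕ) (f g : EPol k n →ₐ[k] EPol k n)
    (hP : ∀ p, f (PE k n p) = g (PE k n p)) (hw : ∀ i, f (wE k n i) = g (wE k n i)) :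
    ∀ x, f x = g x := by
  intro x
  have := skew_zero k n (f.toLinearMap - g.toLinearMap) f g
    (by intro x y; simp [sub_mul, mul_sub]) (by intro p; simp [hP]) (by intro p; simp [hw]) x
  simpa [sub_eq_zero] using this

lemma der_comm (k : Type) [Field k] (n : ℕ) (σ ε : EPol k n →ₐ[k] EPol k n)
    (s : MvPolynomial (Fin n) k → MvPolynomial (Fin n) k)
    (hσ : ∀ p, σ (PE k n p) = PE k n (s p))
    (hσε : ∀ x, σ (ε x) = ε (σ x))
    (B C : EPol k n →ₗ[k] EPol k n)
    (hB : ∀ x y, B (x * y) = B x * y + ε x * B y)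
    (hC : ∀ x y, C (x * y) = C x * y + ε x * C y)
    (hBP : ∀ p, B (PE k n p) = 0) (hCP : ∀ p, C (PE k n p) = 0)
    (hw : ∀ i, B (σ (wE k n i)) = σ (C (wE k n i))) : ∀ x, B (σ x) = σ (C x) := by
  intro x
  have := skew_zero k n (B ∘ₗ σ.toLinearMap - σ.toLinearMap ∘ₗ C) σ (fun x => ε (σ x))
    (by intro x y; simp [hB, hC, hσε, sub_mul, mul_sub]; abel)
    (by intro p; simp [hσ, hBP, hCP]) (by intro p; simp [hw]) x
  simpa [sub_eq_zero] using this

lemma P_inv (k : Type) [Field k] (n N : ℕ) (hn : 0 < n)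
    (P : ℕ → MvPolynomial (Fin n) k)
    (hP0 : P 0 = X (⟨0, hn⟩ : Fin n) ^ N)
    (hPrec : ∀ (r' : ℕ) (hr' : r' + 1 < n),
      (X (fr n r' hr') - X (fr1 n r' hr')) * P (r' + 1) =
        -(P r' - rename (⇑(Equiv.swap (fr n r' hr') (fr1 n r' hr'))) (P r'))) :
    ∀ i, i < n → ∀ (r : ℕ) (hr : r + 1 < n), r ≠ i →
      rename (⇑(Equiv.swap (fr n r hr) (fr1 n r hr))) (P i) = P i := by
  have hX : ∀ a b : Fin n, a ≠ b → (X a - X b : MvPolynomial (Fin n) k) ≠ 0 := by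
    intro a b hab h
    exact hab (X_injective (sub_eq_zero.1 h))
  intro i
  induction i using Nat.strong_induction_on with
  | _ i ih =>
  intro hi r hr hri
  rcases i with _ | i
  · rw [hP0, map_pow, rename_X, Equiv.swap_apply_of_ne_of_ne]
    · simp [fr, Fin.ext_iff]; omega
    · simp [fr1, Fin.ext_iff]
  have hne : fr n i hi ≠ fr1 n i hi := by simp [fr, fr1, Fin.ext_iff]
  have h1 := hPrec i hi
  have h2 := congrArg (rename (⇑(Equiv.swap (fr n r hr) (fr1 n r hr)))) h1
  simp only [map_mul, map_sub, map_neg, rename_X] at h2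
  by_cases hr1 : r = i
  · subst hr1
    rw [rename_rename] at h2
    have hs : (⇑(Equiv.swap (fr n r hr) (fr1 n r hr)) ∘ ⇑(Equiv.swap (fr n r hr) (fr1 n r hr)))
      = id := by ext x; simp
    rw [hs, rename_id_apply, Equiv.swap_apply_left, Equiv.swap_apply_right] at h2
    apply mul_left_cancel₀ (hX _ _ hne)
    linear_combination -h1 - h2
  by_cases hr2 : r + 1 = i
  · subst hr2
    have hf := ih r (by omega) (by omega) (r+1) hi (by omega)
    have h0 := hPrec r hr
    have e1 : fr n (r+1) hi = fr1 n r hr := rfl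
    rw [e1] at hf h1 h2 hne
    set x := fr n r hr with hx
    set y := fr1 n r hr with hy
    set z := fr1 n (r+1) hi with hz
    have hxy : x ≠ y := by simp [hx, hy, fr, fr1, Fin.ext_iff]
    have hxz : x ≠ z := by simp [hx, hz, fr, fr1, Fin.ext_iff]; omega
    have hyz : y ≠ z := hne
    have h3 := congrArg (rename (⇑(Equiv.swap y z))) h0
    simp only [map_mul, map_sub, map_neg, rename_X] at h3
    rw [hf, Equiv.swap_apply_of_ne_of_ne hxy hxz, Equiv.swap_apply_left] at h3
    have key : (X x - X y) * (X x - X z) * (X y - X z) * P (r+1+1)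
      = (X x - X y) * rename (⇑(Equiv.swap y z)) (rename (⇑(Equiv.swap x y)) (P r))
        - (X x - X z) * rename (⇑(Equiv.swap x y)) (P r) + (X y - X z) * P r := by
      linear_combination (X x - X y) * (X x - X z) * h1 - (X x - X z) * h0 + (X x - X y) * h3
    have key2 := congrArg (rename (⇑(Equiv.swap x y))) key
    simp only [map_mul, map_sub, map_add, rename_X] at key2
    rw [Equiv.swap_apply_left, Equiv.swap_apply_right,
      Equiv.swap_apply_of_ne_of_ne hxz.symm hyz.symm] at key2
    have b1 : rename (⇑(Equiv.swap x y)) (rename (⇑(Equiv.swap x y)) (P r)) = P r := by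
      rw [rename_rename]
      have hs : (⇑(Equiv.swap x y) ∘ ⇑(Equiv.swap x y)) = id := by ext x; simp
      rw [hs, rename_id_apply]
    have b2 : rename (⇑(Equiv.swap x y)) (rename (⇑(Equiv.swap y z))
        (rename (⇑(Equiv.swap x y)) (P r))) = rename (⇑(Equiv.swap y z))
        (rename (⇑(Equiv.swap x y)) (P r)) := by
      conv_rhs => rw [← hf]
      simp only [rename_rename]
      congr 1
      congr 1
      exact swap_braid x y z hxy hxz hyz
    rw [b1, b2] at key2
    apply mul_left_cancel₀ (mul_ne_zero (mul_ne_zero (hX _ _ hxy) (hX _ _ hxz)) (hX _ _ hyz))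
    linear_combination - key - key2
  · have hf := ih i (by omega) (by omega) r hr hr1
    have n1 : fr n i hi ≠ fr n r hr := by simp [fr, Fin.ext_iff]; omega
    have n2 : fr n i hi ≠ fr1 n r hr := by simp [fr, fr1, Fin.ext_iff]; omega
    have n3 : fr1 n i hi ≠ fr n r hr := by simp [fr, fr1, Fin.ext_iff]; omega
    have n4 : fr1 n i hi ≠ fr1 n r hr := by simp [fr1, Fin.ext_iff]; omega
    have b : rename (⇑(Equiv.swap (fr n r hr) (fr1 n r hr)))
        (rename (⇑(Equiv.swap (fr n i hi) (fr1 n i hi))) (P i)) =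
        rename (⇑(Equiv.swap (fr n i hi) (fr1 n i hi))) (P i) := by
      conv_rhs => rw [← hf]
      simp only [rename_rename]
      congr 1
      congr 1
      exact swap_far _ _ _ _ n1 n2 n3 n4
    rw [b, hf, Equiv.swap_apply_of_ne_of_ne n1 n2, Equiv.swap_apply_of_ne_of_ne n3 n4, ← h1] at h2
    exact mul_left_cancel₀ (hX _ _ hne) h2

/-- For the supercommutator in `End(EPol_n)` (with `ω_i^±` odd and `X_i, T_r` even):
`[Σ_{i=1}^n P_i ω_i^-, T_r] = 0` where `P_1 = X_1^N`, `P_{r+1} = -∂_r(P_r)`, `T_r = ∂_r`;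
in particular `[P_r, T_r]ω_r^- + P_{r+1}[ω_{r+1}^-, T_r] = 0`. -/
theorem stmt_11 (k : Type) [Field k] (n N : ℕ) (hn : 0 < n) (r : ℕ) (hr : r + 1 < n)
    (σ : EPol k n →ₐ[k] EPol k n)
    (hσX : ∀ i : Fin n, σ (XE k n i) = XE k n (Equiv.swap (fr n r hr) (fr1 n r hr) i))
    (hσω : ∀ i : Fin n, i ≠ fr n r hr → σ (wE k n i) = wE k n i)
    (hσωr : σ (wE k n (fr n r hr)) =
      wE k n (fr n r hr) + (XE k n (fr n r hr) - XE k n (fr1 n r hr)) * wE k n (fr1 n r hr))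
    (D : EPol k n →ₗ[k] EPol k n)
    (hD : ∀ x : EPol k n, (XE k n (fr n r hr) - XE k n (fr1 n r hr)) * D x = x - σ x)
    (ε : EPol k n →ₐ[k] EPol k n)
    (hεP : ∀ P : MvPolynomial (Fin n) k, ε (PE k n P) = PE k n P)
    (hεω : ∀ i : Fin n, ε (wE k n i) = - wE k n i)
    (A : Fin n → (EPol k n →ₗ[k] EPol k n))
    (hAder : ∀ (i : Fin n) (x y : EPol k n), A i (x * y) = A i x * y + ε x * A i y)
    (hAP : ∀ (i : Fin n) (P : MvPolynomial (Fin n) k), A i (PE k n P) = 0)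
    (hAω : ∀ i j : Fin n, A i (wE k n j) = if i = j then 1 else 0)
    (P : ℕ → MvPolynomial (Fin n) k)
    (hP0 : P 0 = X (⟨0, hn⟩ : Fin n) ^ N)
    (hPrec : ∀ (r' : ℕ) (hr' : r' + 1 < n),
      (X (fr n r' hr') - X (fr1 n r' hr')) * P (r' + 1) =
        -(P r' - rename (⇑(Equiv.swap (fr n r' hr') (fr1 n r' hr'))) (P r'))) :
    (∀ x : EPol k n,
      (∑ i : Fin n, PE k n (P i.1) * A i (D x)) =
        D (∑ i : Fin n, PE k n (P i.1) * A i x)) ∧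
    (∀ x : EPol k n,
      (PE k n (P r) * D (A (fr n r hr) x) - D (PE k n (P r) * A (fr n r hr) x)) +
        PE k n (P (r + 1)) * (A (fr1 n r hr) (D x) - D (A (fr1 n r hr) x)) = 0) := by
  have hinv := P_inv k n N hn P hP0 hPrec
  set R := fr n r hr with hR
  set S := fr1 n r hr with hS
  have hRS : R ≠ S := by simp [hR, hS, fr, fr1, Fin.ext_iff]
  have ha : XE k n R - XE k n S = PE k n (X R - X S) := by rw [PE_sub]; rfl
  have ha0 : (X R - X S : MvPolynomial (Fin n) k) ≠ 0 := by
    intro h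
    exact hRS (X_injective (sub_eq_zero.1 h))
  rw [ha] at hσωr
  simp only [ha] at hD
  have hσP : ∀ p, σ (PE k n p) = PE k n (rename (⇑(Equiv.swap R S)) p) := by
    intro p
    have : σ.comp (Algebra.TensorProduct.includeLeft :
          MvPolynomial (Fin n) k →ₐ[k] EPol k n) =
        (Algebra.TensorProduct.includeLeft : MvPolynomial (Fin n) k →ₐ[k] EPol k n).comp
          (rename (⇑(Equiv.swap R S))) := by
      apply MvPolynomial.algHom_ext
      intro i
      simpa [XE] using hσX i
    exact DFunLike.congr_fun this p
  have hσa : rename (⇑(Equiv.swap R S)) (X R - X S : MvPolynomial (Fin n) k) = X S - X R := by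
    simp
  have hσε : ∀ x, σ (ε x) = ε (σ x) := by
    apply hom_ext k n (σ.comp ε) (ε.comp σ)
    · intro p; simp [hεP, hσP]
    · intro i
      by_cases hi : i = R
      · subst hi
        simp only [AlgHom.comp_apply, hεω, hσωr, hεP, map_neg, map_add, map_mul, EPol_mul_neg, neg_add]
      · simp [hεω, hσω i hi]
  have hAPm : ∀ i p x, A i (PE k n p * x) = PE k n p * A i x := by
    intro i p x; rw [hAder, hAP, hεP, zero_mul, zero_add]
  set M : MvPolynomial (Fin n) k → (EPol k n →ₗ[k] EPol k n) :=
    fun p => LinearMap.mulLeft k (PE k n p) with hM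
  have hcm : ∀ p x y, x * (PE k n p * y) = PE k n p * (x * y) := by
    intro p x y; rw [← mul_assoc, PE_comm, mul_assoc]
  have hPr : PE k n (X R - X S) * PE k n (P (r+1)) = σ (PE k n (P r)) - PE k n (P r) := by
    rw [← PE_mul, hPrec r hr, hσP, ← PE_sub]; congr 1; ring
  constructor
  · obtain ⟨Q, hQ⟩ : ∃ Q : EPol k n →ₗ[k] EPol k n,
        ∀ x, Q x = ∑ i : Fin n, PE k n (P i.1) * A i x :=
      ⟨∑ i : Fin n, M (P i.1) ∘ₗ A i, by intro x; simp [hM]⟩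
    have hQd : ∀ x y, Q (x * y) = Q x * y + ε x * Q y := by
      intro x y
      simp only [hQ, hAder, mul_add, Finset.sum_add_distrib, Finset.sum_mul, Finset.mul_sum, hcm,
        mul_assoc]
    have hQP : ∀ p, Q (PE k n p) = 0 := by intro p; simp [hQ, hAP]
    have hQw : ∀ i, Q (wE k n i) = PE k n (P i.1) := by intro i; simp [hQ, hAω]
    have hQPm : ∀ p x, Q (PE k n p * x) = PE k n p * Q x := by
      intro p x; rw [hQd, hQP, hεP, zero_mul, zero_add]
    have hcomm : ∀ x, Q (σ x) = σ (Q x) := by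
      apply der_comm k n σ ε _ hσP hσε Q Q hQd hQd hQP hQP
      intro i
      by_cases hi : i = R
      · rw [hi, hσωr, map_add, hQPm, hQw, hQw]
        change PE k n (P r) + PE k n (X R - X S) * PE k n (P (r+1)) = σ (PE k n (P r))
        rw [hPr]; abel
      · rw [hσω i hi, hQw, hσP, hinv i.1 i.2 r hr]
        intro h; apply hi; rw [hR]; ext; simp [fr, h]
    intro x
    simp only [← hQ]
    apply PE_inj k n _ ha0
    rw [hD, ← hQPm, hD, map_sub, hcomm]
  · have hcomm : ∀ x, A S (σ x) = σ ((A S - M (X R - X S) ∘ₗ A R) x) := by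
      apply der_comm k n σ ε _ hσP hσε _ _ (hAder S) _ (hAP S)
      · intro p; simp [hM, hAP]
      · intro i
        by_cases hi : i = R
        · rw [hi, hσωr, map_add, hAPm]
          simp only [LinearMap.sub_apply, LinearMap.comp_apply, hM, LinearMap.mulLeft_apply, hAω,
            if_neg hRS.symm, if_true, mul_one, map_sub, hσP, map_zero, rename_X,
            Equiv.swap_apply_left, Equiv.swap_apply_right, PE_sub]
          abel
        · rw [hσω i hi]
          simp only [LinearMap.sub_apply, LinearMap.comp_apply, hM, LinearMap.mulLeft_apply, hAω,
            if_neg (Ne.symm hi), mul_zero, sub_zero]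
          split_ifs <;> simp
      · intro x y
        simp only [LinearMap.sub_apply, LinearMap.comp_apply, hM, LinearMap.mulLeft_apply, hAder,
          mul_add, mul_sub, sub_mul, hcm, mul_assoc]
        abel
    intro x
    apply PE_inj k n _ ha0
    have hneg : σ (PE k n (X R - X S)) = - PE k n (X R - X S) := by
      rw [hσP, hσa, PE_sub, PE_sub]; abel
    have e1 := hcomm x
    simp only [LinearMap.sub_apply, LinearMap.comp_apply, hM, LinearMap.mulLeft_apply, map_sub,
      map_mul, hneg, EPol_neg_mul, sub_neg_eq_add] at e1
    rw [mul_zero, mul_add, mul_sub, hD, ← hcm, hD, ← hcm, mul_sub (PE k n (X R - X S)),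
      ← hAPm S (X R - X S) (D x), hD, hD, map_sub, e1,
      map_mul]
    have e2 : σ (PE k n (P r)) = PE k n (P (r+1)) * PE k n (X R - X S) + PE k n (P r) := by
      rw [PE_comm, hPr]; abel
    rw [e2]
    generalize PE k n (X R - X S) = a
    simp only [mul_sub, mul_add, add_mul, mul_assoc]
    abel
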